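/- (Cut elimination for the non-well-founded calculus) If a sequent Γ ⇒ Δ is provable in Go_∞+cut, then Γ ⇒ Δ is provable in Go_∞ (without cut); moreover there is a non-expansive root-preserving mapping ce : P → P such that for every ∞-proof π of Go_∞+cut, ce(π) is a cut-free ∞-proof of the same sequent. -/

import Mathlib

inductive Formula : Type
  | atom : ℕ → Formula
  | bot  : Formula
  | imp  : Formula → Formula → Formula
  | box  : Formula → Formula
deriving DecidableEq

def boxtimes (Γ : Multiset Formula) : Multiset Formula := Γ + Γ.map Formula.box

inductive GoSeq : Bool → Multiset Formula → Multiset Formula → Prop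
  | ax (c) (Γ Δ : Multiset Formula) (A : Formula) : GoSeq c (A ::ₘ Γ) (A ::ₘ Δ)
  | axBot (c) (Γ Δ : Multiset Formula) : GoSeq c (Formula.bot ::ₘ Γ) Δ
  | impL (c) (Γ Δ : Multiset Formula) (A B : Formula) :
      GoSeq c (B ::ₘ Γ) Δ → GoSeq c Γ (A ::ₘ Δ) → GoSeq c ((A.imp B) ::ₘ Γ) Δ
  | impR (c) (Γ Δ : Multiset Formula) (A B : Formula) :
      GoSeq c (A ::ₘ Γ) (B ::ₘ Δ) → GoSeq c Γ ((A.imp B) ::ₘ Δ)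
  | boxGo (c) (Γ Δ Θ : Multiset Formula) (A : Formula) :
      GoSeq c ((Formula.box (A.imp (Formula.box A))) ::ₘ boxtimes Θ) {A} →
      GoSeq c (Γ + Θ.map Formula.box) ((Formula.box A) ::ₘ Δ)
  | cut (Γ Δ : Multiset Formula) (A : Formula) :
      GoSeq true Γ (A ::ₘ Δ) → GoSeq true (A ::ₘ Γ) Δ → GoSeq true Γ Δ

inductive Frag : Bool → ℕ → Multiset Formula → Multiset Formula → Type
  | hole (c) (Γ Δ : Multiset Formula) : Frag c 0 Γ Δ
  | axP (c) (n) (Γ Δ : Multiset Formula) (p : ℕ) :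
      Frag c (n+1) (Formula.atom p ::ₘ Γ) (Formula.atom p ::ₘ Δ)
  | axBot (c) (n) (Γ Δ : Multiset Formula) : Frag c (n+1) (Formula.bot ::ₘ Γ) Δ
  | impL (c) (n) (Γ Δ : Multiset Formula) (A B : Formula) :
      Frag c (n+1) (B ::ₘ Γ) Δ → Frag c (n+1) Γ (A ::ₘ Δ) →
      Frag c (n+1) ((A.imp B) ::ₘ Γ) Δ
  | impR (c) (n) (Γ Δ : Multiset Formula) (A B : Formula) :
      Frag c (n+1) (A ::ₘ Γ) (B ::ₘ Δ) → Frag c (n+1) Γ ((A.imp B) ::ₘ Δ)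
  | box (c) (n) (Γ Δ Θ : Multiset Formula) (l : List Formula) (h : l ≠ []) :
      Frag c (n+1) (boxtimes Θ) (boxtimes (↑l)) →
      ((i : Fin l.length) → Frag c n (boxtimes Θ) {l.get i}) →
      Frag c (n+1) (Γ + Θ.map Formula.box) ((↑(l.map Formula.box) : Multiset Formula) + Δ)
  | cut (n) (Γ Δ : Multiset Formula) (A : Formula) :
      Frag true (n+1) Γ (A ::ₘ Δ) → Frag true (n+1) (A ::ₘ Γ) Δ → Frag true (n+1) Γ Δ

def Frag.trunc : ∀ {c : Bool} {n : ℕ} {Γ Δ : Multiset Formula}, Frag c (n+1) Γ Δ → Frag c n Γ Δ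
  | c, 0, Γ, Δ, _ => .hole c Γ Δ
  | c, n+1, _, _, .axP _ _ Γ Δ p => .axP c n Γ Δ p
  | c, n+1, _, _, .axBot _ _ Γ Δ => .axBot c n Γ Δ
  | c, n+1, _, _, .impL _ _ Γ Δ A B a b => .impL c n Γ Δ A B a.trunc b.trunc
  | c, n+1, _, _, .impR _ _ Γ Δ A B a => .impR c n Γ Δ A B a.trunc
  | c, n+1, _, _, .box _ _ Γ Δ Θ l h a bs => .box c n Γ Δ Θ l h a.trunc (fun i => (bs i).trunc)
  | _, n+1, _, _, .cut _ Γ Δ A a b => .cut n Γ Δ A a.trunc b.trunc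

def Frag.height : ∀ {c : Bool} {n : ℕ} {Γ Δ : Multiset Formula}, Frag c n Γ Δ → ℕ
  | _, _, _, _, .hole _ _ _ => 0
  | _, _, _, _, .axP _ _ _ _ _ => 0
  | _, _, _, _, .axBot _ _ _ _ => 0
  | _, _, _, _, .impL _ _ _ _ _ _ a b => max a.height b.height + 1
  | _, _, _, _, .impR _ _ _ _ _ _ a => a.height + 1
  | _, _, _, _, .box _ _ _ _ _ _ _ a bs =>
      max a.height (Finset.univ.sup fun i => (bs i).height) + 1
  | _, _, _, _, .cut _ _ _ _ a b => max a.height b.height + 1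

def Frag.cutFree : ∀ {c : Bool} {n : ℕ} {Γ Δ : Multiset Formula}, Frag c n Γ Δ → Prop
  | _, _, _, _, .hole _ _ _ => True
  | _, _, _, _, .axP _ _ _ _ _ => True
  | _, _, _, _, .axBot _ _ _ _ => True
  | _, _, _, _, .impL _ _ _ _ _ _ a b => a.cutFree ∧ b.cutFree
  | _, _, _, _, .impR _ _ _ _ _ _ a => a.cutFree
  | _, _, _, _, .box _ _ _ _ _ _ _ a bs => a.cutFree ∧ ∀ i, (bs i).cutFree
  | _, _, _, _, .cut _ _ _ _ _ _ => False

structure InfProof (c : Bool) (Γ Δ : Multiset Formula) : Type where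
  frag : ∀ n : ℕ, Frag c n Γ Δ
  compat : ∀ n : ℕ, (frag (n+1)).trunc = frag n

structure PP : Type where
  Γ : Multiset Formula
  Δ : Multiset Formula
  prf : InfProof true Γ Δ

def Sim : ℕ → PP → PP → Prop
  | 0, _, _ => True
  | n+1, π, τ => π.Γ = τ.Γ ∧ π.Δ = τ.Δ ∧ HEq (π.prf.frag (n+1)) (τ.prf.frag (n+1))

noncomputable def dP (π τ : PP) : ℝ :=
  sInf {r : ℝ | ∃ n : ℕ, Sim n π τ ∧ r = (1/2 : ℝ) ^ n}

def localHeight (π : PP) : ℕ := (π.prf.frag 1).height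

def Pmem (n : ℕ) (π : PP) : Prop := (π.prf.frag n).cutFree

def IsUltrametric {M : Type*} (d : M → M → ℝ) : Prop :=
  (∀ x y, 0 ≤ d x y) ∧ (∀ x y, d x y = 0 ↔ x = y) ∧ (∀ x y, d x y = d y x) ∧
  (∀ x y z, d x z ≤ max (d x y) (d y z))

def cBall {M : Type*} (d : M → M → ℝ) (x : M) (r : ℝ) : Set M := {y | d x y ≤ r}

def SphericallyComplete {M : Type*} (d : M → M → ℝ) : Prop :=
  ∀ (c : ℕ → M) (r : ℕ → ℝ), (∀ n, 0 ≤ r n) →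
    (∀ n, cBall d (c (n+1)) (r (n+1)) ⊆ cBall d (c n) (r n)) →
    ∃ x, ∀ n, x ∈ cBall d (c n) (r n)

def NonExpansive1 (u : PP → PP) : Prop := ∀ π τ, dP (u π) (u τ) ≤ dP π τ

def Adequate1 (u : PP → PP) : Prop := ∀ n π, Pmem n π → Pmem n (u π)

noncomputable def dPm {m : ℕ} (x y : Fin m → PP) : ℝ := ⨆ i, dP (x i) (y i)

def NonExpansiveM {m : ℕ} (u : (Fin m → PP) → PP) : Prop :=
  ∀ x y, dP (u x) (u y) ≤ dPm x y

def Fm (m : ℕ) : Type := {u : (Fin m → PP) → PP // NonExpansiveM u}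

def SimF {m : ℕ} (n k : ℕ) (a b : (Fin m → PP) → PP) : Prop :=
  (∀ x, Sim n (a x) (b x)) ∧
  (∀ x, (∑ i, localHeight (x i)) < k → Sim (n+1) (a x) (b x))

noncomputable def lm {m : ℕ} (a b : (Fin m → PP) → PP) : ℝ :=
  (1/2) * sInf {r : ℝ | ∃ n k : ℕ, SimF n k a b ∧ r = (1/2 : ℝ) ^ n + (1/2 : ℝ) ^ (n + k)}

noncomputable def dP2 (p q : PP × PP) : ℝ := max (dP p.1 q.1) (dP p.2 q.2)

def NonExpansive2 (u : PP × PP → PP) : Prop := ∀ p q, dP (u p) (u q) ≤ dP2 p q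

def Adequate2 (u : PP × PP → PP) : Prop :=
  ∀ n π τ, Pmem n π → Pmem n τ → Pmem n (u (π, τ))

def Removing (A : Formula) (u : PP × PP → PP) : Prop :=
  ∀ (Γ Δ : Multiset Formula) (π τ : PP),
    π.Γ = Γ → π.Δ = A ::ₘ Δ → τ.Γ = A ::ₘ Γ → τ.Δ = Δ →
    (u (π, τ)).Γ = Γ ∧ (u (π, τ)).Δ = Δ

def RA (A : Formula) : Type := {u : PP × PP → PP // NonExpansive2 u ∧ Removing A u}

def SimF2 (n k : ℕ) (a b : PP × PP → PP) : Prop :=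
  (∀ p, Sim n (a p) (b p)) ∧
  (∀ p : PP × PP, localHeight p.1 + localHeight p.2 < k → Sim (n+1) (a p) (b p))

noncomputable def l2 (a b : PP × PP → PP) : ℝ :=
  (1/2) * sInf {r : ℝ | ∃ n k : ℕ, SimF2 n k a b ∧ r = (1/2 : ℝ) ^ n + (1/2 : ℝ) ^ (n + k)}

namespace Go

theorem boxtimes_mono {Γ Γ' : Multiset Formula} (h : Γ ≤ Γ') : boxtimes Γ ≤ boxtimes Γ' :=
  add_le_add h (Multiset.map_le_map h)

theorem boxtimes_cons (A : Formula) (Γ : Multiset Formula) :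
    boxtimes (A ::ₘ Γ) = A ::ₘ A.box ::ₘ boxtimes Γ := by
  simp only [boxtimes, Multiset.map_cons, Multiset.cons_add, Multiset.add_cons,
    Multiset.cons_swap A.box A]

theorem map_box_le_boxtimes (Γ : Multiset Formula) : Γ.map Formula.box ≤ boxtimes Γ :=
  Multiset.le_add_left _ _

theorem box_injective : Function.Injective Formula.box := fun _ _ h => Formula.box.inj h

theorem map_box_union_le {Γ Θ Θ' : Multiset Formula} (h : Θ.map Formula.box ≤ Γ)
    (h' : Θ'.map Formula.box ≤ Γ) : (Θ ∪ Θ').map Formula.box ≤ Γ := by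
  rw [Multiset.map_union box_injective]
  exact Multiset.union_le h h'

theorem map_box_le_of_le_cons {A : Formula} {Γ Θ : Multiset Formula}
    (hA : ∀ B, A ≠ Formula.box B) (h : Θ.map Formula.box ≤ A ::ₘ Γ) : Θ.map Formula.box ≤ Γ := by
  refine (Multiset.le_cons_of_notMem ?_).1 h
  simp only [Multiset.mem_map, not_exists, not_and]
  exact fun B _ hB => hA B hB.symm

theorem map_box_le_cons_box {A : Formula} {Γ Θ : Multiset Formula}
    (h : Θ.map Formula.box ≤ A.box ::ₘ Γ) :
    Θ.map Formula.box ≤ Γ ∨ ∃ Θ', Θ = A ::ₘ Θ' ∧ Θ'.map Formula.box ≤ Γ := by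
  by_cases hA : A ∈ Θ
  · obtain ⟨Θ', rfl⟩ := Multiset.exists_cons_of_mem hA
    rw [Multiset.map_cons, Multiset.cons_le_cons_iff] at h
    exact Or.inr ⟨Θ', rfl, h⟩
  · refine Or.inl ((Multiset.le_cons_of_notMem ?_).1 h)
    simp only [Multiset.mem_map, not_exists, not_and]
    rintro B hB h
    exact hA (box_injective h ▸ hB)

/-- Cut-free derivability of height at most `k`, where the right premises of the modal rule are
taken from the set `H`: `H Θ A` stands for the sequent `⊠Θ ⇒ A`. -/
inductive Der (H : Multiset Formula → Formula → Prop) :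
    ℕ → Multiset Formula → Multiset Formula → Prop
  | axP {k : ℕ} {Γ Δ : Multiset Formula} (p : ℕ) :
      Formula.atom p ∈ Γ → Formula.atom p ∈ Δ → Der H k Γ Δ
  | axBot {k : ℕ} {Γ Δ : Multiset Formula} : Formula.bot ∈ Γ → Der H k Γ Δ
  | impL {k : ℕ} {Γ Δ Γ' : Multiset Formula} {A B : Formula} : Γ = A.imp B ::ₘ Γ' →
      Der H k (B ::ₘ Γ') Δ → Der H k Γ' (A ::ₘ Δ) → Der H (k + 1) Γ Δ
  | impR {k : ℕ} {Γ Δ Δ' : Multiset Formula} {A B : Formula} : Δ = A.imp B ::ₘ Δ' →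
      Der H k (A ::ₘ Γ) (B ::ₘ Δ') → Der H (k + 1) Γ Δ
  | box {k : ℕ} {Γ Δ : Multiset Formula} (Θ L : Multiset Formula) : L ≠ 0 →
      Θ.map Formula.box ≤ Γ → L.map Formula.box ≤ Δ →
      Der H k (boxtimes Θ) (boxtimes L) → (∀ A ∈ L, H Θ A) → Der H (k + 1) Γ Δ

/-- Closure of a set of right premises `⊠Θ ⇒ A` under weakening and cut. -/
structure CutClosed (H : Multiset Formula → Formula → Prop) : Prop where
  weaken {Θ Θ' : Multiset Formula} {A : Formula} : Θ ≤ Θ' → H Θ A → H Θ' A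
  cut {Θ : Multiset Formula} {A B : Formula} : H Θ A → H (A ::ₘ Θ) B → H Θ B

namespace Der

variable {H : Multiset Formula → Formula → Prop}

theorem mono {k k' : ℕ} {Γ Δ : Multiset Formula} (d : Der H k Γ Δ) (hk : k ≤ k') :
    Der H k' Γ Δ := by
  induction d generalizing k' with
  | axP p h h' => exact .axP p h h'
  | axBot h => exact .axBot h
  | impL h _ _ ih ih' =>
    obtain ⟨k', rfl⟩ := Nat.exists_eq_add_of_lt hk
    exact .impL h (ih (by omega)) (ih' (by omega))
  | impR h _ ih =>
    obtain ⟨k', rfl⟩ := Nat.exists_eq_add_of_lt hk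
    exact .impR h (ih (by omega))
  | box Θ L hL hΘ hL' _ hr ih =>
    obtain ⟨k', rfl⟩ := Nat.exists_eq_add_of_lt hk
    exact .box Θ L hL hΘ hL' (ih (by omega)) hr

theorem weaken {k : ℕ} {Γ Δ Γ₁ Δ₁ : Multiset Formula} (d : Der H k Γ Δ) (hΓ : Γ ≤ Γ₁)
    (hΔ : Δ ≤ Δ₁) : Der H k Γ₁ Δ₁ := by
  induction d generalizing Γ₁ Δ₁ with
  | axP p h h' => exact .axP p (Multiset.mem_of_le hΓ h) (Multiset.mem_of_le hΔ h')
  | axBot h => exact .axBot (Multiset.mem_of_le hΓ h)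
  | impL h _ _ ih ih' =>
    subst h
    obtain ⟨Γ₂, rfl⟩ := Multiset.exists_cons_of_mem (Multiset.mem_of_le hΓ
      (Multiset.mem_cons_self _ _))
    rw [Multiset.cons_le_cons_iff] at hΓ
    exact .impL rfl (ih (Multiset.cons_le_cons _ hΓ) hΔ) (ih' hΓ (Multiset.cons_le_cons _ hΔ))
  | impR h _ ih =>
    subst h
    obtain ⟨Δ₂, rfl⟩ := Multiset.exists_cons_of_mem (Multiset.mem_of_le hΔ
      (Multiset.mem_cons_self _ _))
    rw [Multiset.cons_le_cons_iff] at hΔ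
    exact .impR rfl (ih (Multiset.cons_le_cons _ hΓ) (Multiset.cons_le_cons _ hΔ))
  | box Θ L hL hΘ hL' d hr _ => exact .box Θ L hL (hΘ.trans hΓ) (hL'.trans hΔ) d hr

theorem impR_inv {k : ℕ} {Γ Δ Δ' : Multiset Formula} {A B : Formula} (d : Der H k Γ Δ)
    (hΔ : Δ = A.imp B ::ₘ Δ') : Der H k (A ::ₘ Γ) (B ::ₘ Δ') := by
  induction d generalizing Δ' with
  | axP p h h' =>
    subst hΔ
    exact .axP p (Multiset.mem_cons_of_mem h) (by simp at h'; simp [h'])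
  | axBot h => exact .axBot (Multiset.mem_cons_of_mem h)
  | @impL k Γ Δ Γ' C D h _ _ ih ih' =>
    subst h hΔ
    refine .impL (Multiset.cons_swap _ _ _) ?_ ?_
    · rw [Multiset.cons_swap]; exact ih rfl
    · rw [Multiset.cons_swap C B]; exact ih' (Multiset.cons_swap _ _ _)
  | @impR k Γ Δ Δ₁ C D h d ih =>
    subst h
    rcases Multiset.cons_eq_cons.1 hΔ with ⟨hCD, rfl⟩ | ⟨_, Δ₂, rfl, rfl⟩
    · cases hCD
      exact d.mono (Nat.le_succ _)
    · refine .impR (Multiset.cons_swap _ _ _) ?_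
      rw [Multiset.cons_swap, Multiset.cons_swap D]
      exact ih (Multiset.cons_swap _ _ _)
  | box Θ L hL hΘ hL' d hr _ =>
    subst hΔ
    exact .box Θ L hL (hΘ.trans (Multiset.le_cons_self _ _))
      ((map_box_le_of_le_cons (by simp) hL').trans (Multiset.le_cons_self _ _)) d hr

theorem impL_inv_left {k : ℕ} {Γ Δ Γ' : Multiset Formula} {A B : Formula} (d : Der H k Γ Δ)
    (hΓ : Γ = A.imp B ::ₘ Γ') : Der H k (B ::ₘ Γ') Δ := by
  induction d generalizing Γ' with
  | axP p h h' =>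
    subst hΓ
    exact .axP p (by simp at h; simp [h]) h'
  | axBot h =>
    subst hΓ
    exact .axBot (by simp at h; simp [h])
  | @impL k Γ Δ Γ₁ C D h d _ ih ih' =>
    subst h
    rcases Multiset.cons_eq_cons.1 hΓ with ⟨hCD, rfl⟩ | ⟨_, Γ₂, rfl, rfl⟩
    · cases hCD
      exact d.mono (Nat.le_succ _)
    · refine .impL (Multiset.cons_swap _ _ _) ?_ (ih' rfl)
      rw [Multiset.cons_swap]
      exact ih (Multiset.cons_swap _ _ _)
  | @impR k Γ Δ Δ₁ C D h d ih =>
    subst h hΓ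
    refine .impR rfl ?_
    rw [Multiset.cons_swap]
    exact ih (Multiset.cons_swap _ _ _)
  | box Θ L hL hΘ hL' d hr _ =>
    subst hΓ
    exact .box Θ L hL
      ((map_box_le_of_le_cons (by simp) hΘ).trans (Multiset.le_cons_self _ _)) hL' d hr

theorem impL_inv_right {k : ℕ} {Γ Δ Γ' : Multiset Formula} {A B : Formula} (d : Der H k Γ Δ)
    (hΓ : Γ = A.imp B ::ₘ Γ') : Der H k Γ' (A ::ₘ Δ) := by
  induction d generalizing Γ' with
  | axP p h h' =>
    subst hΓ
    exact .axP p (by simpa using h) (Multiset.mem_cons_of_mem h')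
  | axBot h =>
    subst hΓ
    exact .axBot (by simpa using h)
  | @impL k Γ Δ Γ₁ C D h _ d ih ih' =>
    subst h
    rcases Multiset.cons_eq_cons.1 hΓ with ⟨hCD, rfl⟩ | ⟨_, Γ₂, rfl, rfl⟩
    · cases hCD
      exact d.mono (Nat.le_succ _)
    · refine .impL rfl (ih (Multiset.cons_swap _ _ _)) ?_
      rw [Multiset.cons_swap]
      exact ih' rfl
  | @impR k Γ Δ Δ₁ C D h d ih =>
    subst h hΓ
    refine .impR (Multiset.cons_swap _ _ _) ?_
    rw [Multiset.cons_swap]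
    exact ih (Multiset.cons_swap _ _ _)
  | box Θ L hL hΘ hL' d hr _ =>
    subst hΓ
    exact .box Θ L hL (map_box_le_of_le_cons (by simp) hΘ)
      (hL'.trans (Multiset.le_cons_self _ _)) d hr

theorem exists_impL {Γ Δ : Multiset Formula} {A B : Formula}
    (h : ∃ k, Der H k (B ::ₘ Γ) Δ) (h' : ∃ k, Der H k Γ (A ::ₘ Δ)) :
    ∃ k, Der H k (A.imp B ::ₘ Γ) Δ := by
  obtain ⟨k, d⟩ := h
  obtain ⟨k', d'⟩ := h'
  exact ⟨_, .impL rfl (d.mono (le_max_left k k')) (d'.mono (le_max_right k k'))⟩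

/-- The principal case of cut elimination for the modality. -/
theorem cut_box_box
    (hH : CutClosed H) {A : Formula} {k₁ k₂ : ℕ}
    (hsub : ∀ (k₁ k₂ : ℕ) (Γ Δ : Multiset Formula),
      Der H k₁ Γ (A ::ₘ Δ) → Der H k₂ (A ::ₘ Γ) Δ → ∃ k, Der H k Γ Δ)
    (ih₁ : ∀ Γ Δ : Multiset Formula,
      Der H k₁ Γ (A.box ::ₘ Δ) → Der H (k₂ + 1) (A.box ::ₘ Γ) Δ → ∃ k, Der H k Γ Δ)
    (ih₂ : ∀ Γ Δ : Multiset Formula,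
      Der H (k₁ + 1) Γ (A.box ::ₘ Δ) → Der H k₂ (A.box ::ₘ Γ) Δ → ∃ k, Der H k Γ Δ)
    {Γ Δ Θ₁ Θ₂ L₁ L₂ : Multiset Formula}
    (hΘ₁ : Θ₁.map Formula.box ≤ Γ) (hL₁ : L₁.map Formula.box ≤ Δ)
    (d₁ : Der H k₁ (boxtimes Θ₁) (boxtimes (A ::ₘ L₁))) (hr₁ : ∀ B ∈ A ::ₘ L₁, H Θ₁ B)
    (hne : L₂ ≠ 0) (hΘ₂ : Θ₂.map Formula.box ≤ Γ) (hL₂ : L₂.map Formula.box ≤ Δ)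
    (d₂ : Der H k₂ (boxtimes (A ::ₘ Θ₂)) (boxtimes L₂)) (hr₂ : ∀ B ∈ L₂, H (A ::ₘ Θ₂) B) :
    ∃ k, Der H k Γ Δ := by
  have hΘ₁' : Θ₁ ≤ Θ₁ ∪ Θ₂ := Multiset.le_union_left
  have hΘ₂' : Θ₂ ≤ Θ₁ ∪ Θ₂ := Multiset.le_union_right
  have hL₁' : L₁ ≤ L₁ ∪ L₂ := Multiset.le_union_left
  have hL₂' : L₂ ≤ L₁ ∪ L₂ := Multiset.le_union_right
  generalize hΘ : Θ₁ ∪ Θ₂ = Θ at hΘ₁' hΘ₂'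
  generalize hL : L₁ ∪ L₂ = L at hL₁' hL₂'
  have p₁ : Der H (k₁ + 1) (A ::ₘ boxtimes Θ) (A.box ::ₘ boxtimes L) := by
    refine .box Θ₁ (A ::ₘ L₁) (Multiset.cons_ne_zero) ?_ ?_ d₁ hr₁
    · exact ((map_box_le_boxtimes _).trans (boxtimes_mono hΘ₁')).trans (Multiset.le_cons_self _ _)
    · rw [Multiset.map_cons]
      exact Multiset.cons_le_cons _ ((map_box_le_boxtimes _).trans (boxtimes_mono hL₁'))
  have p₂ : Der H (k₂ + 1) (A.box ::ₘ boxtimes Θ) (A ::ₘ boxtimes L) := by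
    refine .box (A ::ₘ Θ₂) L₂ hne ?_ ?_ d₂ hr₂
    · rw [Multiset.map_cons]
      exact Multiset.cons_le_cons _ ((map_box_le_boxtimes _).trans (boxtimes_mono hΘ₂'))
    · exact ((map_box_le_boxtimes _).trans (boxtimes_mono hL₂')).trans (Multiset.le_cons_self _ _)
  rw [boxtimes_cons] at d₁ d₂
  obtain ⟨_, e₁⟩ := ih₁ (boxtimes Θ) (A ::ₘ boxtimes L) (by
    rw [Multiset.cons_swap]
    exact d₁.weaken (boxtimes_mono hΘ₁')
      (Multiset.cons_le_cons _ (Multiset.cons_le_cons _ (boxtimes_mono hL₁')))) p₂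
  obtain ⟨_, e₂⟩ := ih₂ (A ::ₘ boxtimes Θ) (boxtimes L) p₁ (by
    rw [Multiset.cons_swap]
    exact d₂.weaken
      (Multiset.cons_le_cons _ (Multiset.cons_le_cons _ (boxtimes_mono hΘ₂')))
      (boxtimes_mono hL₂'))
  obtain ⟨k, e⟩ := hsub _ _ _ _ e₁ e₂
  refine ⟨k + 1, .box Θ L ?_ ?_ ?_ e fun B hB => ?_⟩
  · rintro rfl
    exact hne (Multiset.le_zero.1 hL₂')
  · exact hΘ ▸ map_box_union_le hΘ₁ hΘ₂
  · exact hL ▸ map_box_union_le hL₁ hL₂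
  · subst hL
    rcases Multiset.mem_union.1 hB with hB | hB
    · exact hH.weaken hΘ₁' (hr₁ B (Multiset.mem_cons_of_mem hB))
    · exact hH.cut (hH.weaken hΘ₁' (hr₁ A (Multiset.mem_cons_self _ _)))
        (hH.weaken (Multiset.cons_le_cons _ hΘ₂') (hr₂ B hB))

/-- Cut admissibility for a formula `A` that is not an implication, given cut admissibility for
`B` whenever `A` is `□B`. -/
theorem cut_of_not_imp
    (hH : CutClosed H) {A : Formula} (hA : ∀ B C, A ≠ Formula.imp B C)
    (hsub : ∀ B, A = Formula.box B → ∀ (k₁ k₂ : ℕ) (Γ Δ : Multiset Formula),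
      Der H k₁ Γ (B ::ₘ Δ) → Der H k₂ (B ::ₘ Γ) Δ → ∃ k, Der H k Γ Δ)
    (m : ℕ) : ∀ (k₁ k₂ : ℕ) (Γ Δ : Multiset Formula), k₁ + k₂ < m →
      Der H k₁ Γ (A ::ₘ Δ) → Der H k₂ (A ::ₘ Γ) Δ → ∃ k, Der H k Γ Δ := by
  induction m with
  | zero => omega
  | succ m ih =>
    intro k₁ k₂ Γ Δ hk d₁ d₂
    have left : (∃ k, Der H k Γ Δ) ∨ (∃ p, A = .atom p ∧ .atom p ∈ Γ) ∨
        ∃ B k Θ L, A = .box B ∧ k₁ = k + 1 ∧ Θ.map Formula.box ≤ Γ ∧ L.map Formula.box ≤ Δ ∧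
          Der H k (boxtimes Θ) (boxtimes (B ::ₘ L)) ∧ ∀ C ∈ B ::ₘ L, H Θ C := by
      generalize hΔ : A ::ₘ Δ = Δ' at d₁
      cases d₁ with
      | axP p h h' =>
        subst hΔ
        rcases Multiset.mem_cons.1 h' with h' | h'
        · exact .inr (.inl ⟨p, h'.symm, h⟩)
        · exact .inl ⟨0, .axP p h h'⟩
      | axBot h => exact .inl ⟨0, .axBot h⟩
      | @impL k _ _ Γ' C D h e e' =>
        subst h hΔ
        refine .inl (exists_impL (ih k k₂ _ _ (by omega) e ?_) (ih k k₂ _ _ (by omega) ?_ ?_))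
        · rw [Multiset.cons_swap]
          exact d₂.impL_inv_left (Multiset.cons_swap _ _ _)
        · rwa [Multiset.cons_swap]
        · exact d₂.impL_inv_right (Multiset.cons_swap _ _ _)
      | @impR k _ _ Δ' C D h e =>
        subst hΔ
        rcases Multiset.cons_eq_cons.1 h with ⟨h, _⟩ | ⟨_, Δ'', rfl, rfl⟩
        · exact absurd h (hA _ _)
        obtain ⟨j, e⟩ := ih k k₂ (C ::ₘ Γ) (D ::ₘ Δ'') (by omega) (by rwa [Multiset.cons_swap])
          (by rw [Multiset.cons_swap]; exact d₂.impR_inv rfl)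
        exact .inl ⟨j + 1, .impR rfl e⟩
      | @box k _ _ Θ L hL hΘ hL' e hr =>
        subst hΔ
        by_cases hbox : ∃ B, A = .box B
        · obtain ⟨B, rfl⟩ := hbox
          rcases map_box_le_cons_box hL' with hL' | ⟨L, rfl, hL''⟩
          · exact .inl ⟨_, .box Θ L hL hΘ hL' e hr⟩
          · exact .inr (.inr ⟨B, k, Θ, L, rfl, rfl, hΘ, hL'', e, hr⟩)
        · exact .inl ⟨_, .box Θ L hL hΘ
            (map_box_le_of_le_cons (fun B hB => hbox ⟨B, hB⟩) hL') e hr⟩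
    have right : (∃ k, Der H k Γ Δ) ∨ A = .bot ∨ (∃ p, A = .atom p ∧ .atom p ∈ Δ) ∨
        ∃ B k Θ L, A = .box B ∧ k₂ = k + 1 ∧ L ≠ 0 ∧ Θ.map Formula.box ≤ Γ ∧
          L.map Formula.box ≤ Δ ∧ Der H k (boxtimes (B ::ₘ Θ)) (boxtimes L) ∧
          ∀ C ∈ L, H (B ::ₘ Θ) C := by
      generalize hΓ : A ::ₘ Γ = Γ' at d₂
      cases d₂ with
      | axP p h h' =>
        subst hΓ
        rcases Multiset.mem_cons.1 h with h | h
        · exact .inr (.inr (.inl ⟨p, h.symm, h'⟩))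
        · exact .inl ⟨0, .axP p h h'⟩
      | axBot h =>
        subst hΓ
        rcases Multiset.mem_cons.1 h with h | h
        · exact .inr (.inl h.symm)
        · exact .inl ⟨0, .axBot h⟩
      | @impL k _ _ Γ' C D h e e' =>
        subst hΓ
        rcases Multiset.cons_eq_cons.1 h with ⟨h, _⟩ | ⟨_, Γ'', rfl, rfl⟩
        · exact absurd h (hA _ _)
        refine .inl (exists_impL (ih k₁ k _ _ (by omega) (d₁.impL_inv_left rfl) ?_)
          (ih k₁ k _ _ (by omega) ?_ e'))
        · rwa [Multiset.cons_swap]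
        · rw [Multiset.cons_swap]
          exact d₁.impL_inv_right rfl
      | @impR k _ _ Δ' C D h e =>
        subst h hΓ
        obtain ⟨j, e⟩ := ih k₁ k (C ::ₘ Γ) (D ::ₘ Δ') (by omega)
          (by rw [Multiset.cons_swap]; exact d₁.impR_inv (Multiset.cons_swap _ _ _))
          (by rwa [Multiset.cons_swap])
        exact .inl ⟨j + 1, .impR rfl e⟩
      | @box k _ _ Θ L hL hΘ hL' e hr =>
        subst hΓ
        by_cases hbox : ∃ B, A = .box B
        · obtain ⟨B, rfl⟩ := hbox
          rcases map_box_le_cons_box hΘ with hΘ | ⟨Θ, rfl, hΘ'⟩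
          · exact .inl ⟨_, .box Θ L hL hΘ hL' e hr⟩
          · exact .inr (.inr (.inr ⟨B, k, Θ, L, rfl, rfl, hL, hΘ', hL', e, hr⟩))
        · exact .inl ⟨_, .box Θ L hL
            (map_box_le_of_le_cons (fun B hB => hbox ⟨B, hB⟩) hΘ) hL' e hr⟩
    rcases left with h | ⟨p, rfl, hp⟩ | ⟨B, j₁, Θ₁, L₁, rfl, rfl, hΘ₁, hL₁, e₁, hr₁⟩
    · exact h
    · rcases right with h | h | ⟨q, h, hq⟩ | ⟨B, _, _, _, h, _⟩
      · exact h
      · cases h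
      · cases h
        exact ⟨0, .axP p hp hq⟩
      · cases h
    · rcases right with h | h | ⟨q, h, _⟩ | ⟨C, j₂, Θ₂, L₂, h, rfl, hne, hΘ₂, hL₂, e₂, hr₂⟩
      · exact h
      · cases h
      · cases h
      · cases h
        exact cut_box_box (A := B) hH (hsub B rfl)
          (fun Γ Δ => ih j₁ (j₂ + 1) Γ Δ (by omega)) (fun Γ Δ => ih (j₁ + 1) j₂ Γ Δ (by omega))
          hΘ₁ hL₁ e₁ hr₁ hne hΘ₂ hL₂ e₂ hr₂

theorem cut
    (hH : CutClosed H) (A : Formula) : ∀ (k₁ k₂ : ℕ) (Γ Δ : Multiset Formula),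
      Der H k₁ Γ (A ::ₘ Δ) → Der H k₂ (A ::ₘ Γ) Δ → ∃ k, Der H k Γ Δ := by
  induction A with
  | atom p =>
    exact fun k₁ k₂ Γ Δ => cut_of_not_imp hH (by simp) (by simp) _ k₁ k₂ Γ Δ
      (Nat.lt_succ_self _)
  | bot =>
    exact fun k₁ k₂ Γ Δ => cut_of_not_imp hH (by simp) (by simp) _ k₁ k₂ Γ Δ
      (Nat.lt_succ_self _)
  | imp A B ihA ihB =>
    intro k₁ k₂ Γ Δ d₁ d₂
    obtain ⟨k, d⟩ := ihA _ _ Γ (B ::ₘ Δ)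
      ((d₂.impL_inv_right rfl).weaken le_rfl
        (Multiset.cons_le_cons _ (Multiset.le_cons_self _ _)))
      (d₁.impR_inv rfl)
    exact ihB _ _ Γ Δ d (d₂.impL_inv_left rfl)
  | box A ih =>
    refine fun k₁ k₂ Γ Δ => cut_of_not_imp hH (by simp) ?_ _ k₁ k₂ Γ Δ (Nat.lt_succ_self _)
    rintro B h
    cases h
    exact ih

end Der

/-- A finite tree of rule applications in which a right premise `⊠Θ ⇒ A` of the modal rule is
labelled by an element of `X Θ A`. -/
inductive Tree (c : Bool) (X : Multiset Formula → Formula → Type) :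
    Multiset Formula → Multiset Formula → Type
  | axP {Γ Δ : Multiset Formula} (Γ' Δ' : Multiset Formula) (p : ℕ)
      (hΓ : Γ = Formula.atom p ::ₘ Γ') (hΔ : Δ = Formula.atom p ::ₘ Δ') : Tree c X Γ Δ
  | axBot {Γ Δ : Multiset Formula} (Γ' : Multiset Formula) (h : Γ = Formula.bot ::ₘ Γ') :
      Tree c X Γ Δ
  | impL {Γ Δ : Multiset Formula} (Γ' : Multiset Formula) (A B : Formula)
      (h : Γ = A.imp B ::ₘ Γ') (a : Tree c X (B ::ₘ Γ') Δ) (b : Tree c X Γ' (A ::ₘ Δ)) :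
      Tree c X Γ Δ
  | impR {Γ Δ : Multiset Formula} (Δ' : Multiset Formula) (A B : Formula)
      (h : Δ = A.imp B ::ₘ Δ') (a : Tree c X (A ::ₘ Γ) (B ::ₘ Δ')) : Tree c X Γ Δ
  | box {Γ Δ : Multiset Formula} (Γ' Δ' Θ : Multiset Formula) (l : List Formula) (hl : l ≠ [])
      (hΓ : Γ = Γ' + Θ.map Formula.box)
      (hΔ : Δ = (↑(l.map Formula.box) : Multiset Formula) + Δ')
      (a : Tree c X (boxtimes Θ) (boxtimes ↑l)) (f : ∀ i : Fin l.length, X Θ (l.get i)) :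
      Tree c X Γ Δ
  | cut {Γ Δ : Multiset Formula} (A : Formula) (hc : c = true) (a : Tree c X Γ (A ::ₘ Δ))
      (b : Tree c X (A ::ₘ Γ) Δ) : Tree c X Γ Δ

theorem eq_cons_erase_of_le {A : Formula} {Γ Γ' Γ₁ : Multiset Formula} (h : Γ = A ::ₘ Γ')
    (hΓ : Γ ≤ Γ₁) : Γ₁ = A ::ₘ Γ₁.erase A :=
  (Multiset.cons_erase (Multiset.mem_of_le hΓ (h ▸ Multiset.mem_cons_self _ _))).symm

theorem le_erase_of_le {A : Formula} {Γ Γ' Γ₁ : Multiset Formula} (h : Γ = A ::ₘ Γ')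
    (hΓ : Γ ≤ Γ₁) : Γ' ≤ Γ₁.erase A := by
  subst h
  simpa using Multiset.erase_le_erase A hΓ

namespace Tree

variable {c : Bool} {X Y Z : Multiset Formula → Formula → Type}

def map (u : ∀ Θ A, X Θ A → Y Θ A) : ∀ {Γ Δ : Multiset Formula}, Tree c X Γ Δ → Tree c Y Γ Δ
  | _, _, .axP Γ' Δ' p hΓ hΔ => .axP Γ' Δ' p hΓ hΔ
  | _, _, .axBot Γ' h => .axBot Γ' h
  | _, _, .impL Γ' A B h a b => .impL Γ' A B h (a.map u) (b.map u)
  | _, _, .impR Δ' A B h a => .impR Δ' A B h (a.map u)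
  | _, _, .box Γ' Δ' Θ l hl hΓ hΔ a f =>
    .box Γ' Δ' Θ l hl hΓ hΔ (a.map u) fun i => u _ _ (f i)
  | _, _, .cut A hc a b => .cut A hc (a.map u) (b.map u)

theorem map_map (u : ∀ Θ A, X Θ A → Y Θ A) (v : ∀ Θ A, Y Θ A → Z Θ A) {Γ Δ : Multiset Formula}
    (t : Tree c X Γ Δ) : (t.map u).map v = t.map fun Θ A x => v Θ A (u Θ A x) := by
  induction t <;> simp_all [map]

def weaken : ∀ {Γ Δ : Multiset Formula}, Tree c X Γ Δ → ∀ {Γ₁ Δ₁ : Multiset Formula},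
    Γ ≤ Γ₁ → Δ ≤ Δ₁ → Tree c X Γ₁ Δ₁
  | _, _, .axP _ _ p h h', Γ₁, Δ₁, hΓ, hΔ =>
    .axP (Γ₁.erase (.atom p)) (Δ₁.erase (.atom p)) p (eq_cons_erase_of_le h hΓ)
      (eq_cons_erase_of_le h' hΔ)
  | _, _, .axBot _ h, Γ₁, _, hΓ, _ => .axBot (Γ₁.erase .bot) (eq_cons_erase_of_le h hΓ)
  | _, _, .impL _ A B h a b, Γ₁, _, hΓ, hΔ =>
    .impL (Γ₁.erase (A.imp B)) A B (eq_cons_erase_of_le h hΓ)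
      (a.weaken (Multiset.cons_le_cons _ (le_erase_of_le h hΓ)) hΔ)
      (b.weaken (le_erase_of_le h hΓ) (Multiset.cons_le_cons _ hΔ))
  | _, _, .impR _ A B h a, _, Δ₁, hΓ, hΔ =>
    .impR (Δ₁.erase (A.imp B)) A B (eq_cons_erase_of_le h hΔ)
      (a.weaken (Multiset.cons_le_cons _ hΓ) (Multiset.cons_le_cons _ (le_erase_of_le h hΔ)))
  | _, _, .box _ _ Θ l hl h h' a f, Γ₁, Δ₁, hΓ, hΔ =>
    .box (Γ₁ - Θ.map Formula.box) (Δ₁ - ↑(l.map Formula.box)) Θ l hl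
      (tsub_add_cancel_of_le ((h ▸ Multiset.le_add_left _ _ : Θ.map Formula.box ≤ _).trans hΓ)).symm
      (add_tsub_cancel_of_le
        ((h' ▸ Multiset.le_add_right _ _ : (↑(l.map Formula.box) : Multiset Formula) ≤ _).trans
          hΔ)).symm a f
  | _, _, .cut A hc a b, _, _, hΓ, hΔ =>
    .cut A hc (a.weaken hΓ (Multiset.cons_le_cons _ hΔ))
      (b.weaken (Multiset.cons_le_cons _ hΓ) hΔ)

theorem map_weaken (u : ∀ Θ A, X Θ A → Y Θ A) {Γ Δ Γ₁ Δ₁ : Multiset Formula} (t : Tree c X Γ Δ)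
    (hΓ : Γ ≤ Γ₁) (hΔ : Δ ≤ Δ₁) : (t.weaken hΓ hΔ).map u = (t.map u).weaken hΓ hΔ := by
  induction t generalizing Γ₁ Δ₁ <;> simp_all [map, weaken]

/-- The tree with all labels forgotten. -/
def shape {Γ Δ : Multiset Formula} (t : Tree c X Γ Δ) : Tree c (fun _ _ => Unit) Γ Δ :=
  t.map fun _ _ _ => ()

theorem shape_map (u : ∀ Θ A, X Θ A → Y Θ A) {Γ Δ : Multiset Formula} (t : Tree c X Γ Δ) :
    (t.map u).shape = t.shape :=
  map_map _ _ _

theorem of_shape_eq_impL {Γ Δ Γ' : Multiset Formula} {A B : Formula} {t : Tree c X Γ Δ}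
    {h : Γ = A.imp B ::ₘ Γ'} {a b} (ht : t.shape = .impL Γ' A B h a b) :
    ∃ a' b', t = .impL Γ' A B h a' b' ∧ a'.shape = a ∧ b'.shape = b := by
  cases t <;> simp [shape, map] at ht
  obtain ⟨rfl, rfl, rfl, h₁, h₂⟩ := ht
  exact ⟨_, _, rfl, eq_of_heq h₁, eq_of_heq h₂⟩

theorem of_shape_eq_impR {Γ Δ Δ' : Multiset Formula} {A B : Formula} {t : Tree c X Γ Δ}
    {h : Δ = A.imp B ::ₘ Δ'} {a} (ht : t.shape = .impR Δ' A B h a) :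
    ∃ a', t = .impR Δ' A B h a' ∧ a'.shape = a := by
  cases t <;> simp [shape, map] at ht
  obtain ⟨rfl, rfl, rfl, h₁⟩ := ht
  exact ⟨_, rfl, eq_of_heq h₁⟩

theorem of_shape_eq_box {Γ Δ Γ' Δ' Θ : Multiset Formula} {l : List Formula} {t : Tree c X Γ Δ}
    {hl hΓ hΔ a f} (ht : t.shape = .box Γ' Δ' Θ l hl hΓ hΔ a f) :
    ∃ a' f', t = .box Γ' Δ' Θ l hl hΓ hΔ a' f' ∧ a'.shape = a := by
  cases t <;> simp [shape, map] at ht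
  obtain ⟨rfl, rfl, rfl, rfl, h₁, h₂⟩ := ht
  exact ⟨_, _, rfl, eq_of_heq h₁⟩

theorem of_shape_eq_cut {Γ Δ : Multiset Formula} {A : Formula} {t : Tree c X Γ Δ}
    {hc a b} (ht : t.shape = .cut A hc a b) :
    ∃ a' b', t = .cut A hc a' b' ∧ a'.shape = a ∧ b'.shape = b := by
  cases t <;> simp [shape, map] at ht
  obtain ⟨rfl, h₁, h₂⟩ := ht
  exact ⟨_, _, rfl, eq_of_heq h₁, eq_of_heq h₂⟩

end Tree

/-- `n`-fragments, presented as trees whose right premises are labelled by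
`(n - 1)`-fragments. -/
def Level (c : Bool) : ℕ → Multiset Formula → Multiset Formula → Type
  | 0, _, _ => Unit
  | n + 1, Γ, Δ => Tree c (fun Θ A => Level c n (boxtimes Θ) {A}) Γ Δ

abbrev RightLevel (c : Bool) (n : ℕ) (Θ : Multiset Formula) (A : Formula) : Type :=
  Level c n (boxtimes Θ) {A}

namespace Level

variable {c : Bool}

def trunc : ∀ (n : ℕ) {Γ Δ : Multiset Formula}, Level c (n + 1) Γ Δ → Level c n Γ Δ
  | 0, _, _, _ => ()
  | n + 1, _, _, t =>
    Tree.map (X := RightLevel c (n + 1)) (Y := RightLevel c n) (fun _ _ => trunc n) t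

def weaken : ∀ (n : ℕ) {Γ Δ Γ₁ Δ₁ : Multiset Formula}, Γ ≤ Γ₁ → Δ ≤ Δ₁ → Level c n Γ Δ →
    Level c n Γ₁ Δ₁
  | 0, _, _, _, _, _, _, _ => ()
  | n + 1, _, _, _, _, hΓ, hΔ, t => Tree.weaken (X := RightLevel c n) t hΓ hΔ

theorem trunc_weaken (n : ℕ) {Γ Δ Γ₁ Δ₁ : Multiset Formula} (hΓ : Γ ≤ Γ₁) (hΔ : Δ ≤ Δ₁)
    (t : Level c (n + 1) Γ Δ) :
    trunc n (weaken (n + 1) hΓ hΔ t) = weaken n hΓ hΔ (trunc n t) := by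
  cases n with
  | zero => rfl
  | succ n => exact Tree.map_weaken _ _ _ _

/-- The cut of `⊠Θ ⇒ A` with `⊠(A, Θ) ⇒ B`, which removes both `A` and `□A`. -/
def cutBoth {Θ : Multiset Formula} {A B : Formula} : ∀ (n : ℕ), RightLevel true n Θ A →
    RightLevel true n (A ::ₘ Θ) B → RightLevel true n Θ B
  | 0, _, _ => ()
  | n + 1, s, t =>
    let X := RightLevel true n
    Tree.cut (X := X) A rfl
      (Tree.weaken (X := X) s le_rfl (Multiset.cons_le_cons A (Multiset.zero_le {B})))
      (.cut A.box rfl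
        (.box (A ::ₘ Θ) {B} Θ [A] (List.cons_ne_nil _ _) (Multiset.cons_add _ _ _).symm rfl
          (Tree.weaken (X := X) s le_rfl (Multiset.le_add_right _ _))
          fun | ⟨0, _⟩ => trunc n s)
        (Tree.weaken (X := X) t (by rw [boxtimes_cons, Multiset.cons_swap]) le_rfl))

theorem trunc_cutBoth {Θ : Multiset Formula} {A B : Formula} (n : ℕ)
    (s : RightLevel true (n + 1) Θ A) (t : RightLevel true (n + 1) (A ::ₘ Θ) B) :
    trunc n (cutBoth (n + 1) s t) = cutBoth n (trunc n s) (trunc n t) := by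
  cases n with
  | zero => rfl
  | succ n =>
    simp only [trunc, cutBoth, Tree.map]
    congr 1
    · exact Tree.map_weaken _ _ _ _
    congr 1
    · congr 1
      · exact Tree.map_weaken _ _ _ _
      · funext i
        match i with
        | ⟨0, _⟩ => rfl
    · exact Tree.map_weaken _ _ _ _

end Level

section Family

variable (G : ℕ → Type) (r : ∀ n, G (n + 1) → G n)

/-- There is a family of `n`-fragments of `⊠Θ ⇒ A`, depending on a parameter in `G n`, that is
compatible with truncation. -/
def HasFamily (Θ : Multiset Formula) (A : Formula) : Prop :=
  ∃ e : ∀ n, G n → RightLevel true n Θ A, ∀ n g, Level.trunc n (e (n + 1) g) = e n (r n g)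

theorem cutClosed_hasFamily : CutClosed (HasFamily G r) where
  weaken := by
    rintro Θ Θ' A h ⟨e, he⟩
    refine ⟨fun n g => Level.weaken n (boxtimes_mono h) le_rfl (e n g), fun n g => ?_⟩
    rw [Level.trunc_weaken, he]
  cut := by
    rintro Θ A B ⟨e, he⟩ ⟨e', he'⟩
    refine ⟨fun n g => Level.cutBoth n (e n g) (e' n g), fun n g => ?_⟩
    rw [Level.trunc_cutBoth, he, he']

variable {G r}

theorem exists_der {Γ Δ : Multiset Formula} (s : Tree true (fun _ _ => Unit) Γ Δ)
    (F : ∀ n, G n → Tree true (RightLevel true n) Γ Δ) (hs : ∀ n g, (F n g).shape = s)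
    (hF : ∀ n g, (F (n + 1) g).map (fun _ _ => Level.trunc n) = F n (r n g)) :
    ∃ k, Der (HasFamily G r) k Γ Δ := by
  induction s with
  | axP Γ' Δ' p hΓ hΔ => exact ⟨0, .axP p (by simp [hΓ]) (by simp [hΔ])⟩
  | axBot Γ' h => exact ⟨0, .axBot (by simp [h])⟩
  | impL Γ' A B h a b iha ihb =>
    choose a' b' ht ha hb using fun n g => Tree.of_shape_eq_impL (hs n g)
    have hab := fun n g => hF n g
    simp only [ht, Tree.map, Tree.impL.injEq, heq_eq_eq, true_and] at hab
    rw [h]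
    exact Der.exists_impL (iha a' ha fun n g => (hab n g).1) (ihb b' hb fun n g => (hab n g).2)
  | impR Δ' A B h a iha =>
    choose a' ht ha using fun n g => Tree.of_shape_eq_impR (hs n g)
    have hab := fun n g => hF n g
    simp only [ht, Tree.map, Tree.impR.injEq, heq_eq_eq, true_and] at hab
    obtain ⟨k, d⟩ := iha a' ha hab
    exact ⟨_, .impR h d⟩
  | box Γ' Δ' Θ l hl hΓ hΔ a f iha =>
    choose a' f' ht ha using fun n g => Tree.of_shape_eq_box (hs n g)
    have hab := fun n g => hF n g
    simp only [ht, Tree.map, Tree.box.injEq, heq_eq_eq, true_and] at hab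
    obtain ⟨k, d⟩ := iha a' ha fun n g => (hab n g).1
    refine ⟨_, .box Θ l (by simpa using hl) (hΓ ▸ Multiset.le_add_left _ _)
      (hΔ ▸ Multiset.le_add_right _ _) d fun A hA => ?_⟩
    obtain ⟨i, rfl⟩ := List.get_of_mem (Multiset.mem_coe.1 hA)
    exact ⟨fun n g => f' n g i, fun n g => congrFun (hab n g).2 i⟩
  | cut A hc a b iha ihb =>
    choose a' b' ht ha hb using fun n g => Tree.of_shape_eq_cut (hs n g)
    have hab := fun n g => hF n g
    simp only [ht, Tree.map, Tree.cut.injEq, heq_eq_eq, true_and] at hab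
    obtain ⟨k, d⟩ := iha a' ha fun n g => (hab n g).1
    obtain ⟨k', d'⟩ := ihb b' hb fun n g => (hab n g).2
    exact Der.cut (cutClosed_hasFamily G r) A k k' _ _ d d'

theorem exists_family {k : ℕ} {Γ Δ : Multiset Formula} (d : Der (HasFamily G r) k Γ Δ) :
    ∃ F : ∀ n, G n → Tree false (RightLevel true n) Γ Δ,
      ∀ n g, (F (n + 1) g).map (fun _ _ => Level.trunc n) = F n (r n g) := by
  induction d with
  | axP p h h' =>
    exact ⟨fun _ _ => .axP _ _ p (Multiset.cons_erase h).symm (Multiset.cons_erase h').symm,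
      fun _ _ => rfl⟩
  | axBot h => exact ⟨fun _ _ => .axBot _ (Multiset.cons_erase h).symm, fun _ _ => rfl⟩
  | impL h _ _ iha ihb =>
    obtain ⟨a, ha⟩ := iha
    obtain ⟨b, hb⟩ := ihb
    exact ⟨fun n g => .impL _ _ _ h (a n g) (b n g), fun n g => by simp only [Tree.map, ha, hb]⟩
  | impR h _ iha =>
    obtain ⟨a, ha⟩ := iha
    exact ⟨fun n g => .impR _ _ _ h (a n g), fun n g => by simp only [Tree.map, ha]⟩
  | @box k Γ Δ Θ L hL hΘ hL' _ hr iha =>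
    obtain ⟨a, ha⟩ := iha
    obtain ⟨l, rfl⟩ := Quot.exists_rep L
    choose f hf using fun i : Fin l.length => hr (l.get i) (List.get_mem l i)
    refine ⟨fun n g => .box (Γ - Θ.map Formula.box) (Δ - ↑(l.map Formula.box)) Θ l
      (by rintro rfl; exact hL rfl) (tsub_add_cancel_of_le hΘ).symm
      (add_tsub_cancel_of_le hL').symm (a n g) fun i => f i n g, fun n g => ?_⟩
    simp only [Tree.map, hf]
    congr 1
    exact ha n g

end Family

/-- The inverse system of trees of a given shape. -/
abbrev OfShape {Γ Δ : Multiset Formula} (s : Tree true (fun _ _ => Unit) Γ Δ) (n : ℕ) : Type :=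
  {t : Tree true (RightLevel true n) Γ Δ // t.shape = s}

theorem exists_cutFree_family {Γ Δ : Multiset Formula} (s : Tree true (fun _ _ => Unit) Γ Δ) :
    ∃ F : ∀ n, OfShape s n → Tree false (RightLevel true n) Γ Δ,
      ∀ n t, (F (n + 1) t).map (fun _ _ => Level.trunc n) =
        F n ⟨t.1.map (fun _ _ => Level.trunc n), (Tree.shape_map _ _).trans t.2⟩ := by
  obtain ⟨_, d⟩ := exists_der (r := fun n (t : OfShape s (n + 1)) =>
      ⟨t.1.map (fun _ _ => Level.trunc n), (Tree.shape_map _ _).trans t.2⟩) s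
    (fun n (t : OfShape s n) => t.1) (fun _ t => t.2) fun _ _ => rfl
  exact exists_family d

/-- Elimination of the cuts outside the right premises of the modal rule. -/
noncomputable def eliminateMain (n : ℕ) {Γ Δ : Multiset Formula}
    (t : Tree true (RightLevel true n) Γ Δ) : Tree false (RightLevel true n) Γ Δ :=
  (exists_cutFree_family t.shape).choose n ⟨t, rfl⟩

theorem map_trunc_eliminateMain (n : ℕ) {Γ Δ : Multiset Formula}
    (t : Tree true (RightLevel true (n + 1)) Γ Δ) :
    (eliminateMain (n + 1) t).map (fun _ _ => Level.trunc n) =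
      eliminateMain n (t.map fun _ _ => Level.trunc n) := by
  have key : ∀ s (h : (t.map fun _ _ => Level.trunc n).shape = s),
      (exists_cutFree_family s).choose n ⟨_, h⟩ =
        eliminateMain n (t.map fun _ _ => Level.trunc n) := by
    rintro _ rfl
    rfl
  exact ((exists_cutFree_family t.shape).choose_spec n ⟨t, rfl⟩).trans (key _ _)

namespace Level

noncomputable def eliminate : ∀ (n : ℕ) {Γ Δ : Multiset Formula}, Level true n Γ Δ →
    Level false n Γ Δ
  | 0, _, _, _ => ()
  | n + 1, _, _, t => Tree.map (X := RightLevel true n) (Y := RightLevel false n)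
      (fun _ _ => eliminate n) (eliminateMain n t)

theorem map_trunc_map_eliminate (n : ℕ)
    (ih : ∀ {Γ Δ : Multiset Formula} (t : Level true (n + 1) Γ Δ),
      trunc n (eliminate (n + 1) t) = eliminate n (trunc n t))
    {Γ Δ : Multiset Formula} (t : Tree true (RightLevel true (n + 1)) Γ Δ) :
    ((eliminateMain (n + 1) t).map (Y := RightLevel false (n + 1))
        fun _ _ => eliminate (n + 1)).map (Y := RightLevel false n) (fun _ _ => trunc n) =
      (eliminateMain n (t.map fun _ _ => trunc n)).map (Y := RightLevel false n)
        fun _ _ => eliminate n := by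
  rw [← map_trunc_eliminateMain, Tree.map_map, Tree.map_map]
  congr 1
  funext Θ A x
  exact ih x

theorem trunc_eliminate : ∀ (n : ℕ) {Γ Δ : Multiset Formula} (t : Level true (n + 1) Γ Δ),
    trunc n (eliminate (n + 1) t) = eliminate n (trunc n t)
  | 0, _, _, _ => rfl
  | n + 1, _, _, t => map_trunc_map_eliminate n (trunc_eliminate n) t

/-- Presentation of a fragment as a tree. -/
def ofFrag {c : Bool} : ∀ {n : ℕ} {Γ Δ : Multiset Formula}, Frag c n Γ Δ → Level c n Γ Δ
  | _, _, _, .hole _ _ _ => ()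
  | _, _, _, .axP _ n Γ Δ p => Tree.axP (X := RightLevel c n) Γ Δ p rfl rfl
  | _, _, _, .axBot _ n Γ _ => Tree.axBot (X := RightLevel c n) Γ rfl
  | _, _, _, .impL _ n Γ _ A B a b =>
    Tree.impL (X := RightLevel c n) Γ A B rfl (ofFrag a) (ofFrag b)
  | _, _, _, .impR _ n _ Δ A B a => Tree.impR (X := RightLevel c n) Δ A B rfl (ofFrag a)
  | _, _, _, .box _ n Γ Δ Θ l h a bs =>
    Tree.box (X := RightLevel c n) Γ Δ Θ l h rfl rfl (ofFrag a) fun i => ofFrag (bs i)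
  | _, _, _, .cut n _ _ A a b => Tree.cut (X := RightLevel true n) A rfl (ofFrag a) (ofFrag b)

theorem ofFrag_trunc {c : Bool} : ∀ {n : ℕ} {Γ Δ : Multiset Formula} (a : Frag c (n + 1) Γ Δ),
    ofFrag a.trunc = trunc n (ofFrag a)
  | 0, _, _, _ => rfl
  | _ + 1, _, _, .axP _ _ _ _ _ => by
    simp only [Frag.trunc, ofFrag]
    rfl
  | _ + 1, _, _, .axBot _ _ _ _ => by
    simp only [Frag.trunc, ofFrag]
    rfl
  | n + 1, _, _, .impL _ _ Γ _ A B a b => by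
    simp only [Frag.trunc, ofFrag]
    exact congrArg₂ (Tree.impL (X := RightLevel c n) Γ A B rfl) (ofFrag_trunc a) (ofFrag_trunc b)
  | n + 1, _, _, .impR _ _ _ Δ A B a => by
    simp only [Frag.trunc, ofFrag]
    exact congrArg (Tree.impR (X := RightLevel c n) Δ A B rfl) (ofFrag_trunc a)
  | n + 1, _, _, .box _ _ Γ Δ Θ l h a bs => by
    simp only [Frag.trunc, ofFrag]
    exact congrArg₂ (Tree.box (X := RightLevel c n) Γ Δ Θ l h rfl rfl) (ofFrag_trunc a)
      (funext fun i => ofFrag_trunc (bs i))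
  | n + 1, _, _, .cut _ _ _ A a b => by
    simp only [Frag.trunc, ofFrag]
    exact congrArg₂ (Tree.cut (X := RightLevel true n) A rfl) (ofFrag_trunc a) (ofFrag_trunc b)

end Level

/-- Transport of a fragment along equalities of sequents. -/
def castFrag {c : Bool} {n : ℕ} {Γ Δ Γ' Δ' : Multiset Formula} (hΓ : Γ = Γ') (hΔ : Δ = Δ')
    (a : Frag c n Γ' Δ') : Frag c n Γ Δ :=
  hΓ ▸ hΔ ▸ a

theorem castFrag_trunc {c : Bool} {n : ℕ} {Γ Δ Γ' Δ' : Multiset Formula} (hΓ : Γ = Γ')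
    (hΔ : Δ = Δ') (a : Frag c (n + 1) Γ' Δ') :
    (castFrag hΓ hΔ a).trunc = castFrag hΓ hΔ a.trunc := by
  subst hΓ hΔ
  rfl

theorem castFrag_cutFree {c : Bool} {n : ℕ} {Γ Δ Γ' Δ' : Multiset Formula} (hΓ : Γ = Γ')
    (hΔ : Δ = Δ') (a : Frag c n Γ' Δ') : (castFrag hΓ hΔ a).cutFree ↔ a.cutFree := by
  subst hΓ hΔ
  rfl

namespace Tree

variable {X : Multiset Formula → Formula → Type} {n : ℕ}

def toFrag (c : Bool) (u : ∀ Θ A, X Θ A → Frag c n (boxtimes Θ) {A}) :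
    ∀ {Γ Δ : Multiset Formula}, Tree false X Γ Δ → Frag c (n + 1) Γ Δ
  | _, _, .axP Γ' Δ' p hΓ hΔ => castFrag hΓ hΔ (.axP c n Γ' Δ' p)
  | _, Δ, .axBot Γ' h => castFrag h rfl (.axBot c n Γ' Δ)
  | _, Δ, .impL Γ' A B h a b => castFrag h rfl (.impL c n Γ' Δ A B (a.toFrag c u) (b.toFrag c u))
  | Γ, _, .impR Δ' A B h a => castFrag rfl h (.impR c n Γ Δ' A B (a.toFrag c u))
  | _, _, .box Γ' Δ' Θ l hl hΓ hΔ a f =>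
    castFrag hΓ hΔ (.box c n Γ' Δ' Θ l hl (a.toFrag c u) fun i => u _ _ (f i))
  | _, _, .cut _ hc _ _ => absurd hc Bool.false_ne_true

theorem cutFree_toFrag {c : Bool} (u : ∀ Θ A, X Θ A → Frag c n (boxtimes Θ) {A})
    (hu : ∀ Θ A x, (u Θ A x).cutFree) {Γ Δ : Multiset Formula} (t : Tree false X Γ Δ) :
    (t.toFrag c u).cutFree := by
  induction t with
  | cut _ hc => exact absurd hc Bool.false_ne_true
  | _ => simp_all [toFrag, castFrag_cutFree, Frag.cutFree]

theorem trunc_toFrag {Y : Multiset Formula → Formula → Type} {c : Bool}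
    (u : ∀ Θ A, X Θ A → Frag c (n + 1) (boxtimes Θ) {A})
    (v : ∀ Θ A, Y Θ A → Frag c n (boxtimes Θ) {A}) (w : ∀ Θ A, X Θ A → Y Θ A)
    (h : ∀ Θ A x, (u Θ A x).trunc = v Θ A (w Θ A x)) {Γ Δ : Multiset Formula}
    (t : Tree false X Γ Δ) : (t.toFrag c u).trunc = (t.map w).toFrag c v := by
  induction t with
  | cut _ hc => exact absurd hc Bool.false_ne_true
  | _ => simp_all [toFrag, castFrag_trunc, Frag.trunc, map]

end Tree

namespace Level

def toFrag (c : Bool) : ∀ (n : ℕ) {Γ Δ : Multiset Formula}, Level false n Γ Δ → Frag c n Γ Δ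
  | 0, Γ, Δ, _ => .hole c Γ Δ
  | n + 1, _, _, t => Tree.toFrag (X := RightLevel false n) c (fun _ _ => toFrag c n) t

theorem cutFree_toFrag (c : Bool) : ∀ (n : ℕ) {Γ Δ : Multiset Formula} (t : Level false n Γ Δ),
    (toFrag c n t).cutFree
  | 0, _, _, _ => trivial
  | n + 1, _, _, t => Tree.cutFree_toFrag _ (fun _ _ => cutFree_toFrag c n) t

theorem trunc_toFrag (c : Bool) : ∀ (n : ℕ) {Γ Δ : Multiset Formula}
    (t : Level false (n + 1) Γ Δ), (toFrag c (n + 1) t).trunc = toFrag c n (trunc n t)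
  | 0, _, _, _ => by simp only [Frag.trunc, toFrag]
  | n + 1, _, _, t => Tree.trunc_toFrag _ _ _ (fun _ _ => trunc_toFrag c n) t

end Level

/-- Cut elimination for ∞-proofs, with values in either calculus. -/
noncomputable def eliminateCuts (c : Bool) {Γ Δ : Multiset Formula} (π : InfProof true Γ Δ) :
    InfProof c Γ Δ where
  frag n := Level.toFrag c n (Level.eliminate n (Level.ofFrag (π.frag n)))
  compat n := by
    rw [Level.trunc_toFrag, Level.trunc_eliminate, ← Level.ofFrag_trunc, π.compat]

noncomputable def eliminateCutsPP (π : PP) : PP := ⟨π.Γ, π.Δ, eliminateCuts true π.prf⟩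

theorem sim_eliminateCutsPP {n : ℕ} {π τ : PP} (h : Sim n π τ) :
    Sim n (eliminateCutsPP π) (eliminateCutsPP τ) := by
  cases n with
  | zero => trivial
  | succ n =>
    obtain ⟨Γ, Δ, π⟩ := π
    obtain ⟨Γ', Δ', τ⟩ := τ
    obtain ⟨hΓ, hΔ, h⟩ := h
    dsimp only at hΓ hΔ h
    subst hΓ hΔ
    refine ⟨rfl, rfl, heq_of_eq ?_⟩
    simp only [eliminateCutsPP, eliminateCuts, eq_of_heq h]

theorem nonExpansive_of_sim {u : PP → PP} (h : ∀ n π τ, Sim n π τ → Sim n (u π) (u τ)) :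
    NonExpansive1 u := by
  intro π τ
  refine csInf_le_csInf ⟨0, ?_⟩ ⟨1, 0, trivial, by simp⟩ ?_
  · rintro _ ⟨n, _, rfl⟩
    positivity
  · rintro _ ⟨n, hn, rfl⟩
    exact ⟨n, h n π τ hn, rfl⟩

end Go

theorem stmt19 :
    (∀ Γ Δ : Multiset Formula,
      Nonempty (InfProof true Γ Δ) → Nonempty (InfProof false Γ Δ)) ∧
    (∃ ce : PP → PP, NonExpansive1 ce ∧
      (∀ π : PP, (ce π).Γ = π.Γ ∧ (ce π).Δ = π.Δ) ∧
      (∀ (π : PP) (n : ℕ), ((ce π).prf.frag n).cutFree)) := by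
  refine ⟨fun Γ Δ ⟨π⟩ => ⟨Go.eliminateCuts false π⟩, Go.eliminateCutsPP,
    Go.nonExpansive_of_sim fun _ _ _ => Go.sim_eliminateCutsPP, fun _ => ⟨rfl, rfl⟩,
    fun π n => Go.Level.cutFree_toFrag true n _⟩
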